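/- arXiv:2402.16845 — 3 statements merged into one kernel-verified Lean document; each statement's English description precedes it below -/
import Mathlib

section
/- Let S ∈ ℕ, let K : Fin S → ℝⁿ be a kernel with zero mean, i.e. Σ_{i=1}^{S} K i = 0, let z : Fin S → ℝᵈ be stencil offsets, and let v : ℝᵈ → ℝⁿ be differentiable at y ∈ ℝᵈ. Then lim_{h → 0⁺} (1/h) Σ_{i=1}^{S} ⟪K i, v(y + h • z i)⟫ = Σ_{j=1}^{n} ⟪∇v_j(y), b_j⟫, where for each channel j the direction b_j ∈ ℝᵈ is given explicitly by b_j = Σ_{i=1}^{S} (K i)_j • z i. -/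
open scoped RealInnerProductSpace
open Filter Topology

/-- The discrete convolution is differentiable in the grid width at `0`. -/
theorem hasDerivAt_sum_inner_comp_add_smul {ι E F : Type*} [Fintype ι]
    [NormedAddCommGroup E] [NormedSpace ℝ E] [NormedAddCommGroup F] [InnerProductSpace ℝ F]
    (K : ι → F) (z : ι → E) {v : E → F} {y : E} (hv : DifferentiableAt ℝ v y) :
    HasDerivAt (fun h : ℝ => ∑ i, ⟪K i, v (y + h • z i)⟫)
      (∑ i, ⟪K i, fderiv ℝ v y (z i)⟫) 0 := by
  refine HasDerivAt.fun_sum fun i _ => ?_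
  have hline : HasDerivAt (fun h : ℝ => v (y + h • z i)) (fderiv ℝ v y (z i)) 0 :=
    hv.hasFDerivAt.hasLineDerivAt (z i)
  simpa using (hasDerivAt_const (0 : ℝ) (K i)).inner ℝ hline

/-- The gradient of a component of `v` represents that component of the derivative of `v`. -/
theorem inner_gradient_apply {ι E : Type*} [Fintype ι]
    [NormedAddCommGroup E] [InnerProductSpace ℝ E] [CompleteSpace E]
    {v : E → EuclideanSpace ℝ ι} {y : E} (hv : DifferentiableAt ℝ v y) (j : ι) (w : E) :
    ⟪gradient (fun x => v x j) y, w⟫ = fderiv ℝ v y w j := by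
  have hj : HasFDerivAt (fun x => v x j) ((EuclideanSpace.proj j).comp (fderiv ℝ v y)) y :=
    (EuclideanSpace.proj (𝕜 := ℝ) j).hasFDerivAt.comp y hv.hasFDerivAt
  rw [gradient, InnerProductSpace.toDual_symm_apply, hj.fderiv]
  rfl

/-- If the kernel `K` has zero mean, the rescaled discrete convolution converges, as the
grid width tends to zero, to the first-order differential operator
`∑ j ⟪∇ v_j (y), b j⟫` with `b j = ∑ i (K i) j • z i`. -/
theorem stmt_1 {d n S : ℕ} (K : Fin S → EuclideanSpace ℝ (Fin n))
    (hK : ∑ i : Fin S, K i = 0)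
    (z : Fin S → EuclideanSpace ℝ (Fin d))
    (v : EuclideanSpace ℝ (Fin d) → EuclideanSpace ℝ (Fin n))
    (y : EuclideanSpace ℝ (Fin d)) (hv : DifferentiableAt ℝ v y) :
    Tendsto (fun h : ℝ => (1 / h) * ∑ i : Fin S, ⟪K i, v (y + h • z i)⟫)
      (𝓝[>] (0 : ℝ))
      (𝓝 (∑ j : Fin n, ⟪gradient (fun x => v x j) y, ∑ i : Fin S, K i j • z i⟫)) := by
  have hderiv := (hasDerivAt_sum_inner_comp_add_smul K z hv).tendsto_slope_zero_right
  have hlim : ∑ j : Fin n, ⟪gradient (fun x => v x j) y, ∑ i : Fin S, K i j • z i⟫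
      = ∑ i, ⟪K i, fderiv ℝ v y (z i)⟫ := by
    simp_rw [inner_sum, inner_smul_right, inner_gradient_apply hv]
    rw [Finset.sum_comm]
    simp [PiLp.inner_apply, mul_comm]
  rw [hlim]
  simpa [← sum_inner, hK] using hderiv
end

section
/- (First-order differential layer.) Let S ∈ ℕ, let z : Fin S → ℝᵈ be stencil offsets, and let K : Fin S → ℝⁿ be any kernel with mean K̄ = (1/S) Σ_{i=1}^{S} K i. Then there exist vectors b_1, …, b_n ∈ ℝᵈ, depending only on K and z, such that for every continuously differentiable function v : ℝᵈ → ℝⁿ and every y ∈ ℝᵈ, lim_{h → 0⁺} (1/h) Σ_{i=1}^{S} ⟪K i − K̄, v(y + h • z i)⟫ = Σ_{j=1}^{n} ⟪∇v_j(y), b_j⟫. -/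
open scoped RealInnerProductSpace
open Filter Topology

/-- If the vectors `w i` sum to zero, the convolution with kernel `w`, rescaled by `1 / h`, converges
to the corresponding combination of directional derivatives. -/
theorem tendsto_inv_mul_sum_inner_of_sum_eq_zero {ι E F : Type*} [Fintype ι]
    [NormedAddCommGroup E] [NormedSpace ℝ E] [NormedAddCommGroup F] [InnerProductSpace ℝ F]
    {w : ι → F} (hw : ∑ i, w i = 0) (z : ι → E) {v : E → F} {v' : E →L[ℝ] F} {y : E}
    (hv : HasFDerivAt v v' y) :
    Tendsto (fun h : ℝ => (1 / h) * ∑ i, ⟪w i, v (y + h • z i)⟫) (𝓝[>] (0 : ℝ))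
      (𝓝 (∑ i, ⟪w i, v' (z i)⟫)) := by
  have hderiv : HasDerivAt (fun h : ℝ => ∑ i, ⟪w i, v (y + h • z i)⟫)
      (∑ i, ⟪w i, v' (z i)⟫) 0 := by
    refine HasDerivAt.fun_sum fun i _ => ?_
    have hline : HasDerivAt (fun h : ℝ => v (y + h • z i)) (v' (z i)) 0 :=
      hv.hasLineDerivAt (z i)
    exact (innerSL ℝ (w i)).hasFDerivAt.comp_hasDerivAt 0 hline
  simpa [← sum_inner, hw] using hderiv.tendsto_slope_zero_right

/-- Subtracting the mean from a finite family makes its sum vanish. -/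
theorem sum_sub_mean_eq_zero {F : Type*} [AddCommGroup F] [Module ℝ F] {S : ℕ} (K : Fin S → F) :
    ∑ i, (K i - (S : ℝ)⁻¹ • ∑ i', K i') = 0 := by
  rcases Nat.eq_zero_or_pos S with rfl | hS
  · simp
  · have hS' : (S : ℝ) ≠ 0 := by positivity
    rw [Finset.sum_sub_distrib, Finset.sum_const, Finset.card_univ, Fintype.card_fin,
      ← Nat.cast_smul_eq_nsmul ℝ, smul_inv_smul₀ hS', sub_self]

/-- First-order differential layer: for any kernel `K` with mean `K̄ = (1/S) ∑ K i`,
there are directions `b j` (depending only on `K` and `z`) such that for every `C¹`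
function `v` and every point `y`, the rescaled mean-centered convolution converges to
`∑ j ⟪∇ v_j (y), b j⟫` as the grid width tends to zero. -/
theorem stmt_2 {d n S : ℕ} (z : Fin S → EuclideanSpace ℝ (Fin d))
    (K : Fin S → EuclideanSpace ℝ (Fin n)) :
    ∃ b : Fin n → EuclideanSpace ℝ (Fin d),
      ∀ v : EuclideanSpace ℝ (Fin d) → EuclideanSpace ℝ (Fin n), ContDiff ℝ 1 v →
        ∀ y : EuclideanSpace ℝ (Fin d),
          Tendsto (fun h : ℝ => (1 / h) *
              ∑ i : Fin S, ⟪K i - (S : ℝ)⁻¹ • ∑ i' : Fin S, K i', v (y + h • z i)⟫)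
            (𝓝[>] (0 : ℝ))
            (𝓝 (∑ j : Fin n, ⟪gradient (fun x => v x j) y, b j⟫)) := by
  refine ⟨fun j => ∑ i, (K i - (S : ℝ)⁻¹ • ∑ i', K i') j • z i, fun v hv y => ?_⟩
  have hdiff : DifferentiableAt ℝ v y := hv.differentiable one_ne_zero y
  convert tendsto_inv_mul_sum_inner_of_sum_eq_zero (sum_sub_mean_eq_zero K) z
    hdiff.hasFDerivAt using 2
  have hcoord (j : Fin n) (x : EuclideanSpace ℝ (Fin d)) :
      ⟪gradient (fun x => v x j) y, x⟫ = fderiv ℝ v y x j := by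
    have h : HasFDerivAt (fun x => v x j) ((EuclideanSpace.proj j).comp (fderiv ℝ v y)) y :=
      (EuclideanSpace.proj (𝕜 := ℝ) j).hasFDerivAt.comp y hdiff.hasFDerivAt
    rw [gradient, InnerProductSpace.toDual_symm_apply, h.fderiv]
    rfl
  simp_rw [inner_sum, real_inner_smul_right, hcoord, PiLp.inner_apply]
  rw [Finset.sum_comm]
  simp [mul_comm]
end

section
/- Let S ∈ ℕ, let K : Fin S → ℝⁿ satisfy Σ_{i=1}^{S} K i = 0, let z : Fin S → ℝᵈ be stencil offsets, let y ∈ ℝᵈ, h > 0, and C ≥ 0. Suppose v : ℝᵈ → ℝⁿ is twice differentiable on the closed ball of radius h · max_i ‖z i‖ around y with ‖D²v(x)‖ ≤ C (operator norm of the second derivative as a bilinear map) for all x in that ball. Then |(1/h) Σ_{i=1}^{S} ⟪K i, v(y + h • z i)⟫ − Σ_{i=1}^{S} ⟪K i, Dv(y)(z i)⟫| ≤ (C h / 2) Σ_{i=1}^{S} ‖K i‖ ‖z i‖². -/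
open scoped RealInnerProductSpace

/-- Second-order Taylor estimate in a convex set on which the second derivative is bounded. -/
theorem norm_image_add_sub_sub_fderiv_le {E F : Type*} [NormedAddCommGroup E] [NormedSpace ℝ E]
    [NormedAddCommGroup F] [NormedSpace ℝ F] {v : E → F} {s : Set E} {C : ℝ} {y w : E}
    (hs : Convex ℝ s) (hy : y ∈ s) (hw : y + w ∈ s)
    (hv1 : ∀ x ∈ s, DifferentiableAt ℝ v x)
    (hv2 : ∀ x ∈ s, DifferentiableAt ℝ (fderiv ℝ v) x)
    (hbound : ∀ x ∈ s, ‖fderiv ℝ (fderiv ℝ v) x‖ ≤ C) :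
    ‖v (y + w) - v y - fderiv ℝ v y w‖ ≤ C / 2 * ‖w‖ ^ 2 := by
  have hmem : ∀ t ∈ Set.Icc (0 : ℝ) 1, y + t • w ∈ s := fun t ht =>
    hs.add_smul_mem hy hw ht
  let f : ℝ → F := fun t => v (y + t • w) - v y - t • fderiv ℝ v y w
  have hf : ∀ t ∈ Set.Icc (0 : ℝ) 1,
      HasDerivAt f (fderiv ℝ v (y + t • w) w - fderiv ℝ v y w) t := by
    intro t ht
    have hline : HasDerivAt (fun t : ℝ => y + t • w) w t := by
      simpa using ((hasDerivAt_id t).smul_const w).const_add y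
    have hcomp := (hv1 _ (hmem t ht)).hasFDerivAt.comp_hasDerivAt t hline
    have hlin : HasDerivAt (fun t : ℝ => t • fderiv ℝ v y w) (fderiv ℝ v y w) t := by
      simpa using (hasDerivAt_id t).smul_const (fderiv ℝ v y w)
    exact (hcomp.sub_const (v y)).sub hlin
  have hB : ∀ t : ℝ, HasDerivAt (fun t : ℝ => C / 2 * ‖w‖ ^ 2 * t ^ 2) (C * ‖w‖ ^ 2 * t) t := by
    intro t
    have hd := (hasDerivAt_pow 2 t).const_mul (C / 2 * ‖w‖ ^ 2)
    have heq : C / 2 * ‖w‖ ^ 2 * (((2 : ℕ) : ℝ) * t ^ (2 - 1)) = C * ‖w‖ ^ 2 * t := by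
      norm_num
      ring
    exact heq ▸ hd
  have hf' : ∀ t ∈ Set.Ico (0 : ℝ) 1,
      ‖fderiv ℝ v (y + t • w) w - fderiv ℝ v y w‖ ≤ C * ‖w‖ ^ 2 * t := by
    intro t ht
    have hlip := hs.norm_image_sub_le_of_norm_fderiv_le hv2 hbound hy
      (hmem t (Set.Ico_subset_Icc_self ht))
    rw [add_sub_cancel_left, norm_smul, Real.norm_of_nonneg ht.1] at hlip
    calc ‖fderiv ℝ v (y + t • w) w - fderiv ℝ v y w‖
        ≤ ‖fderiv ℝ v (y + t • w) - fderiv ℝ v y‖ * ‖w‖ :=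
          (fderiv ℝ v (y + t • w) - fderiv ℝ v y).le_opNorm w
      _ ≤ C * (t * ‖w‖) * ‖w‖ := by gcongr
      _ = C * ‖w‖ ^ 2 * t := by ring
  have hmain := image_norm_le_of_norm_deriv_right_le_deriv_boundary
    (fun t ht => (hf t ht).continuousAt.continuousWithinAt)
    (fun t ht => (hf t (Set.Ico_subset_Icc_self ht)).hasDerivWithinAt)
    (by simp [f]) hB hf' (Set.right_mem_Icc.2 zero_le_one)
  simpa [f] using hmain

/-- Quantitative convergence rate of the rescaled zero-mean differential layer to its
limiting first-order differential operator: if `v` is twice differentiable with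
`‖D²v‖ ≤ C` on the closed ball of radius `h * max_i ‖z i‖` around `y`, then the error is
bounded by `(C h / 2) ∑ ‖K i‖ ‖z i‖²`. -/
theorem stmt_14 {d n S : ℕ} (K : Fin S → EuclideanSpace ℝ (Fin n))
    (hK : ∑ i : Fin S, K i = 0)
    (z : Fin S → EuclideanSpace ℝ (Fin d))
    (y : EuclideanSpace ℝ (Fin d)) (h C : ℝ) (hh : 0 < h) (hC : 0 ≤ C)
    (v : EuclideanSpace ℝ (Fin d) → EuclideanSpace ℝ (Fin n))
    (hv1 : ∀ x ∈ Metric.closedBall y (h * ⨆ i : Fin S, ‖z i‖), DifferentiableAt ℝ v x)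
    (hv2 : ∀ x ∈ Metric.closedBall y (h * ⨆ i : Fin S, ‖z i‖),
      DifferentiableAt ℝ (fderiv ℝ v) x)
    (hbound : ∀ x ∈ Metric.closedBall y (h * ⨆ i : Fin S, ‖z i‖),
      ‖fderiv ℝ (fderiv ℝ v) x‖ ≤ C) :
    |(1 / h) * ∑ i : Fin S, ⟪K i, v (y + h • z i)⟫ -
        ∑ i : Fin S, ⟪K i, fderiv ℝ v y (z i)⟫|
      ≤ C * h / 2 * ∑ i : Fin S, ‖K i‖ * ‖z i‖ ^ 2 := by
  have hterm : ∀ i, ‖v (y + h • z i) - v y - fderiv ℝ v y (h • z i)‖ ≤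
      C / 2 * ‖h • z i‖ ^ 2 := by
    intro i
    have hsup : ‖z i‖ ≤ ⨆ j, ‖z j‖ :=
      le_ciSup (f := fun j => ‖z j‖) (Set.finite_range _).bddAbove i
    refine norm_image_add_sub_sub_fderiv_le (convex_closedBall _ _)
      (Metric.mem_closedBall_self ?_) ?_ hv1 hv2 hbound
    · exact mul_nonneg hh.le ((norm_nonneg _).trans hsup)
    · rw [Metric.mem_closedBall, dist_self_add_left, norm_smul, Real.norm_of_nonneg hh.le]
      gcongr
  have hzero : ∑ i : Fin S, ⟪K i, v y⟫ = 0 := by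
    rw [← sum_inner, hK, inner_zero_left]
  have hsum : (1 / h) * ∑ i : Fin S, ⟪K i, v (y + h • z i)⟫ -
        ∑ i : Fin S, ⟪K i, fderiv ℝ v y (z i)⟫ =
      ∑ i : Fin S, (1 / h) * ⟪K i, v (y + h • z i) - v y - fderiv ℝ v y (h • z i)⟫ := by
    simp only [inner_sub_right, map_smul, real_inner_smul_right, ← Finset.mul_sum,
      Finset.sum_sub_distrib, hzero]
    field_simp
    ring
  rw [hsum, Finset.mul_sum]
  refine (Finset.abs_sum_le_sum_abs _ _).trans (Finset.sum_le_sum fun i _ => ?_)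
  rw [abs_mul, abs_of_pos (one_div_pos.2 hh)]
  calc 1 / h * |⟪K i, v (y + h • z i) - v y - fderiv ℝ v y (h • z i)⟫|
      ≤ 1 / h * (‖K i‖ * (C / 2 * ‖h • z i‖ ^ 2)) := by
        gcongr
        exact (abs_real_inner_le_norm _ _).trans (by gcongr; exact hterm i)
    _ = C * h / 2 * (‖K i‖ * ‖z i‖ ^ 2) := by
        rw [norm_smul, Real.norm_of_nonneg hh.le]
        field_simp
end
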